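/- If 2 ≤ t+1 < r < n, then l(𝖯_{n,r}, t) ≥ ((n−t−1)/(r−t−1))·l(𝖯_{n,r}, t+1); equivalently, (r−t−1)·l(𝖯_{n,r}, t) ≥ (n−t−1)·l(𝖯_{n,r}, t+1). -/

import Mathlib

open Finset

section Defs

variable {α : Type*} [DecidableEq α]

/-- `famStar F T` is ℱ(T) = {F ∈ ℱ : T ⊆ F}. -/
def famStar (F : Finset (Finset α)) (T : Finset α) : Finset (Finset α) :=
  F.filter (fun A => T ⊆ A)

/-- `lstar F t` is l(ℱ,t): the maximum of |ℱ(T)| over all t-element sets T. -/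
noncomputable def lstar (F : Finset (Finset α)) (t : ℕ) : ℕ :=
  sSup {n : ℕ | ∃ T : Finset α, T.card = t ∧ n = (famStar F T).card}

/-- c(r,s,t) = max{r·C(s,t), s·C(r,t)} + 1 if t ≤ min{r,s}, and 1 otherwise. -/
def cfun (r s t : ℕ) : ℕ :=
  if t ≤ min r s then max (r * Nat.choose s t) (s * Nat.choose r t) + 1 else 1

/-- The tuple (𝒜_1, …, 𝒜_k) is cross-t-intersecting. -/
def CrossTuple (t : ℕ) {k : ℕ} (A : Fin k → Finset (Finset α)) : Prop :=
  ∀ i j : Fin k, i ≠ j → ∀ a ∈ A i, ∀ b ∈ A j, t ≤ (a ∩ b).card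

/-- The cross-t-star property. -/
def CrossTStar (t : ℕ) {k : ℕ} (F : Fin k → Finset (Finset α)) : Prop :=
  ∀ A : Fin k → Finset (Finset α), CrossTuple t A → (∀ i, A i ⊆ F i) →
    ∏ i, (A i).card ≤ ∏ i, lstar (F i) t

/-- The strict cross-t-star property. -/
def StrictCrossTStar (t : ℕ) {k : ℕ} (F : Fin k → Finset (Finset α)) : Prop :=
  ∀ A : Fin k → Finset (Finset α), CrossTuple t A → (∀ i, A i ⊆ F i) →
    ∏ i, (A i).card ≤ ∏ i, lstar (F i) t ∧
      ((¬ ∃ T : Finset α, T.card = t ∧ ∀ i, A i = famStar (F i) T) →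
        ∏ i, (A i).card < ∏ i, lstar (F i) t)

/-- The strong cross-t-star property. -/
def StrongCrossTStar (t : ℕ) {k : ℕ} (F : Fin k → Finset (Finset α)) : Prop :=
  ∃ T : Finset α, T.card = t ∧
    ∀ A : Fin k → Finset (Finset α), CrossTuple t A → (∀ i, A i ⊆ F i) →
      ∏ i, (A i).card ≤ ∏ i, (famStar (F i) T).card

/-- The extrastrong cross-t-star property. -/
def ExtrastrongCrossTStar (t : ℕ) {k : ℕ} (F : Fin k → Finset (Finset α)) : Prop :=
  ∃ T : Finset α, T.card = t ∧
    ∀ A : Fin k → Finset (Finset α), CrossTuple t A → (∀ i, A i ⊆ F i) →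
      ∏ i, (A i).card ≤ ∏ i, (famStar (F i) T).card ∧
        (∏ i, (A i).card = ∏ i, (famStar (F i) T).card →
          ∃ T' : Finset α, T'.card = t ∧ ∀ i, A i = famStar (F i) T')

/-- 𝒮_{X,m}: the family of subsets of X × [m] that are graphs of functions
from X to [m]; 𝒮_{∅,m} = ∅. -/
def seqFam (X : Finset α) (m : ℕ) : Finset (Finset (α × ℕ)) :=
  (X ×ˢ Finset.Icc 1 m).powerset.filter
    (fun S => S.Nonempty ∧ S.image Prod.fst = X ∧ S.card = X.card)

/-- 𝒮_{ℱ,m} = ⋃_{F ∈ ℱ} 𝒮_{F,m}. -/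
def seqFamU (F : Finset (Finset α)) (m : ℕ) : Finset (Finset (α × ℕ)) :=
  F.biUnion (fun X => seqFam X m)

/-- 𝒮*_{X,m}: the family of subsets of X × [m] that are graphs of injective
functions from X to [m]; 𝒮*_{∅,m} = ∅. -/
def seqFamInj (X : Finset α) (m : ℕ) : Finset (Finset (α × ℕ)) :=
  (seqFam X m).filter (fun S => (S.image Prod.snd).card = S.card)

/-- 𝒮*_{ℱ,m} = ⋃_{F ∈ ℱ} 𝒮*_{F,m}. -/
def seqFamInjU (F : Finset (Finset α)) (m : ℕ) : Finset (Finset (α × ℕ)) :=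
  F.biUnion (fun X => seqFamInj X m)

end Defs

open Classical in
/-- ℳ_{n,r}: representations S_A of multisets A with members in [n] of total size r:
the r-element sets S of pairs (a,j) with a ∈ [n], 1 ≤ j, such that (a,j) ∈ S and
1 ≤ j' ≤ j imply (a,j') ∈ S. -/
noncomputable def multFam (n r : ℕ) : Finset (Finset (ℕ × ℕ)) :=
  (Finset.Icc 1 n ×ˢ Finset.Icc 1 r).powerset.filter
    (fun S => S.card = r ∧ ∀ p ∈ S, ∀ j ∈ Finset.Icc 1 p.2, (p.1, j) ∈ S)

/-- 𝒞_{n,r}: representations S_a = {(1,a_1),…,(r,a_r)} of compositions (a_1,…,a_r)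
of n of length r, i.e. graphs of functions from [r] to positive integers summing to n. -/
def compFam (n r : ℕ) : Finset (Finset (ℕ × ℕ)) :=
  (Finset.Icc 1 r ×ˢ Finset.Icc 1 n).powerset.filter
    (fun S => S.image Prod.fst = Finset.Icc 1 r ∧ S.card = r ∧ ∑ p ∈ S, p.2 = n)

/-- 𝖯_{n,r}: the family of partitions of [n] of length r, each partition viewed
as the set of its parts. -/
def partFam (n r : ℕ) : Finset (Finset (Finset ℕ)) :=
  (Finset.Icc 1 n).powerset.powerset.filter
    (fun P => P.card = r ∧ (∀ X ∈ P, X ≠ ∅) ∧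
      (∀ X ∈ P, ∀ Y ∈ P, X ≠ Y → X ∩ Y = ∅) ∧
      P.biUnion id = Finset.Icc 1 n)

/-- s_{n,r} = |𝖯_{n,r}|, the Stirling number of the second kind. -/
def stirling (n r : ℕ) : ℕ := (partFam n r).card
namespace Nat

theorem stirlingSecond_mono_left {k : ℕ} (hk : k ≠ 0) : Monotone (stirlingSecond · k) := by
  refine monotone_nat_of_le_succ fun n => ?_
  simp only [stirlingSecond_succ_left n k hk]
  have := Nat.mul_le_mul_right (stirlingSecond n k) (Nat.one_le_iff_ne_zero.2 hk)
  omega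

theorem mul_stirlingSecond_le_mul_stirlingSecond_succ (j d : ℕ) :
    d * stirlingSecond (j + d) j ≤ (j + 1) * j * stirlingSecond (j + d) (j + 1) := by
  induction h : j + d generalizing j d with
  | zero =>
    obtain rfl : d = 0 := by omega
    simp
  | succ N ih =>
    cases j with
    | zero => simp
    | succ i =>
      have h₁ := ih i d (by omega)
      rw [stirlingSecond_succ_succ, stirlingSecond_succ_succ]
      cases d with
      | zero => simp
      | succ e =>
        have h₂ := ih (i + 1) e (by omega)
        generalize stirlingSecond N i = x at *
        generalize stirlingSecond N (i + 1) = y at *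
        generalize stirlingSecond N (i + 1 + 1) = z at *
        nlinarith [Nat.mul_le_mul_left (i + 2) h₂, Nat.zero_le (i * y), Nat.zero_le (e * y)]

theorem mul_stirlingSecond_le_mul_stirlingSecond_succ_succ {m j : ℕ} (h : j ≤ m) :
    m * stirlingSecond m j ≤ j * stirlingSecond (m + 1) (j + 1) := by
  obtain ⟨d, rfl⟩ := Nat.exists_eq_add_of_le h
  rw [stirlingSecond_succ_succ]
  linarith [mul_stirlingSecond_le_mul_stirlingSecond_succ j d]

end Nat

section SetPartitions

variable {α : Type*}

/-- `P` is a set of nonempty, pairwise disjoint sets with union `B`. -/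
def IsSetPartition (B : Finset α) (P : Finset (Finset α)) : Prop :=
  ∅ ∉ P ∧ (∀ X ∈ P, ∀ Y ∈ P, ∀ a, a ∈ X → a ∈ Y → X = Y) ∧ ∀ a, a ∈ B ↔ ∃ X ∈ P, a ∈ X

open Classical in
/-- The partitions of `B` into `k` parts. -/
noncomputable def setPartitions (B : Finset α) (k : ℕ) : Finset (Finset (Finset α)) :=
  B.powerset.powerset.filter fun P => P.card = k ∧ IsSetPartition B P

theorem mem_setPartitions {B : Finset α} {k : ℕ} {P : Finset (Finset α)} :
    P ∈ setPartitions B k ↔ P.card = k ∧ IsSetPartition B P := by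
  simp only [setPartitions, mem_filter, mem_powerset, and_iff_right_iff_imp]
  rintro ⟨-, -, -, h⟩ X hX
  exact mem_powerset.2 fun a ha => (h a).2 ⟨X, hX, ha⟩

theorem IsSetPartition.notMem_of_notMem {B : Finset α} {P : Finset (Finset α)}
    (h : IsSetPartition B P) {a : α} (ha : a ∉ B) {X : Finset α} (hX : X ∈ P) : a ∉ X :=
  fun haX => ha ((h.2.2 a).2 ⟨X, hX, haX⟩)

theorem IsSetPartition.disjoint {B C : Finset α} {P Q : Finset (Finset α)}
    (hP : IsSetPartition B P) (hQ : IsSetPartition C Q) (hBC : Disjoint B C) :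
    Disjoint P Q := by
  rw [Finset.disjoint_left] at hBC ⊢
  intro X hXP hXQ
  obtain ⟨a, ha⟩ := Finset.nonempty_iff_ne_empty.2 fun h => hP.1 (h ▸ hXP)
  exact hBC ((hP.2.2 a).2 ⟨X, hXP, ha⟩) ((hQ.2.2 a).2 ⟨X, hXQ, ha⟩)

theorem IsSetPartition.card_le {B : Finset α} {P : Finset (Finset α)}
    (hP : IsSetPartition B P) : P.card ≤ B.card := by
  have h : ∀ X : Finset α, X ∈ P → ∃ a, a ∈ X := fun X hX =>
    Finset.nonempty_iff_ne_empty.2 fun h => hP.1 (h ▸ hX)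
  choose f hf using h
  rw [← card_attach]
  refine card_le_card_of_injOn (fun X => f X.1 X.2) ?_ ?_
  · exact fun X _ => (hP.2.2 _).2 ⟨X.1, X.2, hf X.1 X.2⟩
  · intro X _ Y _ hXY
    refine Subtype.ext (hP.2.1 X.1 X.2 Y.1 Y.2 _ (hf X.1 X.2) ?_)
    rw [show f X.1 X.2 = f Y.1 Y.2 from hXY]
    exact hf Y.1 Y.2

variable [DecidableEq α]

/-- Disjoint unions of partitions are partitions. -/
theorem IsSetPartition.union {B C : Finset α} {P Q : Finset (Finset α)}
    (hP : IsSetPartition B P) (hQ : IsSetPartition C Q) (hBC : Disjoint B C) :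
    IsSetPartition (B ∪ C) (P ∪ Q) := by
  have h : ∀ X ∈ P, ∀ Y ∈ Q, ∀ a, a ∈ X → a ∉ Y := fun X hX Y hY a haX haY =>
    disjoint_left.1 hBC ((hP.2.2 a).2 ⟨X, hX, haX⟩) ((hQ.2.2 a).2 ⟨Y, hY, haY⟩)
  unfold IsSetPartition at *
  grind

theorem IsSetPartition.subset {B : Finset α} {P T : Finset (Finset α)}
    (hP : IsSetPartition B P) (hT : T ⊆ P) : IsSetPartition (T.biUnion id) T := by
  refine ⟨fun h => hP.1 (hT h), fun X hX Y hY => hP.2.1 X (hT hX) Y (hT hY), fun a => by simp⟩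

theorem IsSetPartition.sdiff {B : Finset α} {P T : Finset (Finset α)}
    (hP : IsSetPartition B P) (hT : T ⊆ P) : IsSetPartition (B \ T.biUnion id) (P \ T) := by
  obtain ⟨h₀, h₁, h₂⟩ := hP
  refine ⟨by grind, by grind, fun a => ?_⟩
  simp only [mem_sdiff, mem_biUnion, id, h₂]
  grind

theorem isSetPartition_image_singleton (B : Finset α) :
    IsSetPartition B (B.image singleton) := by
  refine ⟨by simp, ?_, by simp⟩
  simp only [mem_image]
  rintro _ ⟨x, -, rfl⟩ _ ⟨y, -, rfl⟩ a hx hy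
  simp_all

theorem card_filter_singleton_mem_setPartitions_insert {B : Finset α} {a : α} (ha : a ∉ B)
    (k : ℕ) : #{P ∈ setPartitions (insert a B) (k + 1) | {a} ∈ P} = #(setPartitions B k) := by
  have hs : IsSetPartition ({a} : Finset α) {{a}} := by
    simpa using isSetPartition_image_singleton ({a} : Finset α)
  have hd : Disjoint {a} B := by simpa using ha
  refine card_nbij' (fun P => P \ {{a}}) (fun P => {{a}} ∪ P) ?_ ?_ ?_ ?_
  · intro P hP
    simp only [coe_filter, Set.mem_ofPred_eq, mem_setPartitions] at hP
    obtain ⟨⟨hc, hP⟩, haP⟩ := hP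
    refine mem_setPartitions.2 ⟨?_, ?_⟩
    · rw [card_sdiff_of_subset (by simpa using haP)]
      simp [hc]
    · have := hP.sdiff (T := {{a}}) (by simpa using haP)
      have h : insert a B \ ({{a}} : Finset (Finset α)).biUnion id = B := by
        ext x; simp; grind
      rwa [h] at this
  · intro P hP
    obtain ⟨hc, hP⟩ := mem_setPartitions.1 hP
    simp only [coe_filter, Set.mem_ofPred_eq, mem_setPartitions]
    refine ⟨⟨?_, ?_⟩, by simp⟩
    · rw [card_union_of_disjoint (hs.disjoint hP hd)]
      simp [hc, add_comm]
    · exact hs.union hP hd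
  · intro P hP
    simp only [coe_filter, Set.mem_ofPred_eq] at hP
    exact union_sdiff_of_subset (by simpa using hP.2)
  · intro P hP
    exact union_sdiff_cancel_left (hs.disjoint (mem_setPartitions.1 hP).2 hd)

theorem card_filter_singleton_notMem_setPartitions_insert {B : Finset α} {a : α} (ha : a ∉ B)
    (k : ℕ) :
    #{P ∈ setPartitions (insert a B) k | {a} ∉ P} = k * #(setPartitions B k) := by
  have hcard : #((setPartitions B k).sigma id) = k * #(setPartitions B k) := by
    rw [card_sigma, mul_comm]
    exact sum_const_nat fun P hP => (mem_setPartitions.1 hP).1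
  rw [← hcard]
  symm
  refine card_bij (fun q _ => insert (insert a q.2) (q.1.erase q.2)) ?_ ?_ ?_
  · rintro ⟨Q, X⟩ h
    simp only [mem_sigma, id, mem_setPartitions] at h
    obtain ⟨⟨hc, hQ⟩, hX⟩ := h
    have haQ : ∀ Y ∈ Q, a ∉ Y := fun Y hY => hQ.notMem_of_notMem ha hY
    simp only [mem_filter, mem_setPartitions]
    refine ⟨⟨?_, ?_, ?_, ?_⟩, ?_⟩
    · rw [card_insert_of_notMem, card_erase_add_one hX, hc]
      exact fun h => haQ _ (mem_of_mem_erase h) (mem_insert_self a X)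
    · have := hQ.1
      grind
    · have := hQ.2.1
      grind
    · have := hQ.2.2
      intro x
      simp only [mem_insert, this, exists_eq_or_imp, mem_erase]
      constructor
      · rintro (rfl | ⟨Y, hY, hxY⟩)
        · exact .inl (.inl rfl)
        · by_cases h : Y = X
          · exact .inl (.inr (h ▸ hxY))
          · exact .inr ⟨Y, ⟨h, hY⟩, hxY⟩
      · rintro ((rfl | hx) | ⟨Y, ⟨-, hY⟩, hxY⟩)
        · exact .inl rfl
        · exact .inr ⟨X, hX, hx⟩
        · exact .inr ⟨Y, hY, hxY⟩
    · have := hQ.1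
      intro h
      rcases mem_insert.1 h with h | h
      · have : X = ∅ := by
          rw [← erase_insert (haQ X hX), ← h]; simp
        grind
      · exact haQ _ (mem_of_mem_erase h) (mem_singleton_self a)
  · rintro ⟨Q, X⟩ h ⟨Q', X'⟩ h' heq
    simp only [mem_sigma, id, mem_setPartitions] at h h' heq
    obtain ⟨⟨-, hQ⟩, hX⟩ := h
    obtain ⟨⟨-, hQ'⟩, hX'⟩ := h'
    have haQ : ∀ Y ∈ Q, a ∉ Y := fun Y hY => hQ.notMem_of_notMem ha hY
    have haQ' : ∀ Y ∈ Q', a ∉ Y := fun Y hY => hQ'.notMem_of_notMem ha hY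
    have hins : insert a X = insert a X' := by
      have : insert a X ∈ insert (insert a X') (Q'.erase X') := heq ▸ mem_insert_self _ _
      rcases mem_insert.1 this with h | h
      · exact h
      · exact absurd (mem_insert_self a X) (haQ' _ (mem_of_mem_erase h))
    obtain rfl : X = X' := by
      rw [← erase_insert (haQ X hX), hins, erase_insert (haQ' X' hX')]
    have h₁ : insert a X ∉ Q.erase X := fun h =>
      haQ _ (mem_of_mem_erase h) (mem_insert_self a X)
    have h₂ : insert a X ∉ Q'.erase X := fun h =>
      haQ' _ (mem_of_mem_erase h) (mem_insert_self a X)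
    have : Q.erase X = Q'.erase X := by
      rw [← erase_insert h₁, heq, erase_insert h₂]
    obtain rfl : Q = Q' := by rw [← insert_erase hX, this, insert_erase hX']
    rfl
  · intro P hP
    simp only [mem_filter, mem_setPartitions] at hP
    obtain ⟨⟨hc, h₀, h₁, h₂⟩, haP⟩ := hP
    obtain ⟨Y, hY, haY⟩ := (h₂ a).1 (mem_insert_self a B)
    have hX₀ : Y.erase a ≠ ∅ := by
      intro h
      rw [erase_eq_empty_iff] at h
      rcases h with h | h
      · exact h₀ (h ▸ hY)
      · exact haP (h ▸ hY)
    have hXP : Y.erase a ∉ P.erase Y := by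
      obtain ⟨b, hb⟩ := nonempty_iff_ne_empty.2 hX₀
      intro h
      exact (mem_erase.1 h).1 (h₁ _ (mem_of_mem_erase h) _ hY b hb (mem_of_mem_erase hb))
    refine ⟨⟨insert (Y.erase a) (P.erase Y), Y.erase a⟩, ?_, ?_⟩
    · simp only [mem_sigma, id, mem_setPartitions, mem_insert_self, and_true]
      refine ⟨?_, ?_, ?_, ?_⟩
      · rw [card_insert_of_notMem hXP, card_erase_add_one hY, hc]
      · grind
      · grind
      · intro x
        have := h₂ x
        grind
    · simp only
      rw [erase_insert hXP, insert_erase haY, insert_erase hY]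

theorem card_setPartitions_insert {B : Finset α} {a : α} (ha : a ∉ B) (k : ℕ) :
    #(setPartitions (insert a B) (k + 1)) =
      (k + 1) * #(setPartitions B (k + 1)) + #(setPartitions B k) := by
  rw [← card_filter_add_card_filter_not (fun P => {a} ∈ P),
    card_filter_singleton_mem_setPartitions_insert ha,
    card_filter_singleton_notMem_setPartitions_insert ha, add_comm]

theorem card_setPartitions (B : Finset α) (k : ℕ) :
    #(setPartitions B k) = Nat.stirlingSecond #B k := by
  induction B using Finset.induction_on generalizing k with
  | empty =>
    have h : ∀ P, P ∈ setPartitions (∅ : Finset α) k ↔ P = ∅ ∧ k = 0 := by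
      intro P
      rw [mem_setPartitions]
      constructor
      · rintro ⟨hc, h₀, -, h₂⟩
        have hP : P = ∅ := by
          refine eq_empty_of_forall_notMem fun X hX => ?_
          obtain ⟨a, ha⟩ := nonempty_iff_ne_empty.2 fun h => h₀ (h ▸ hX)
          exact notMem_empty a ((h₂ a).2 ⟨X, hX, ha⟩)
        exact ⟨hP, by simpa [hP] using hc.symm⟩
      · rintro ⟨rfl, rfl⟩
        simp [IsSetPartition]
    cases k with
    | zero =>
      rw [card_empty, Nat.stirlingSecond_zero, card_eq_one]
      exact ⟨∅, by ext P; simp [h]⟩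
    | succ k =>
      rw [card_empty, Nat.stirlingSecond_zero_succ, card_eq_zero]
      exact eq_empty_of_forall_notMem fun P hP => by simp [h] at hP
  | insert a B ha ih =>
    rw [card_insert_of_notMem ha]
    cases k with
    | zero =>
      rw [Nat.stirlingSecond_succ_zero, card_eq_zero]
      refine eq_empty_of_forall_notMem fun P hP => ?_
      obtain ⟨hc, -, -, h⟩ := mem_setPartitions.1 hP
      rw [card_eq_zero] at hc
      subst hc
      simpa using (h a).1 (mem_insert_self a B)
    | succ k => rw [card_setPartitions_insert ha, ih, ih, Nat.stirlingSecond_succ_succ]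

/-- A partition `T` of a subset of `B` extends to as many partitions of `B` as there are
partitions of the rest. -/
theorem card_famStar_setPartitions {B C : Finset α} {T : Finset (Finset α)}
    (hT : IsSetPartition C T) (hC : C ⊆ B) {k : ℕ} (hk : #T ≤ k) :
    #(famStar (setPartitions B k) T) = Nat.stirlingSecond (#B - #C) (k - #T) := by
  rw [← card_sdiff_of_subset hC, ← card_setPartitions]
  have hCT : T.biUnion id = C := by
    ext a; simp [hT.2.2]
  refine card_nbij' (fun P => P \ T) (fun P => T ∪ P) ?_ ?_ ?_ ?_
  · intro P hP
    simp only [famStar, coe_filter, Set.mem_ofPred_eq, mem_setPartitions] at hP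
    obtain ⟨⟨hc, hP⟩, hTP⟩ := hP
    exact mem_setPartitions.2 ⟨by rw [card_sdiff_of_subset hTP, hc], hCT ▸ hP.sdiff hTP⟩
  · intro P hP
    obtain ⟨hc, hP⟩ := mem_setPartitions.1 hP
    simp only [famStar, coe_filter, Set.mem_ofPred_eq, mem_setPartitions]
    refine ⟨⟨?_, ?_⟩, subset_union_left⟩
    · rw [card_union_of_disjoint (hT.disjoint hP disjoint_sdiff), hc]
      omega
    · simpa [union_sdiff_of_subset hC] using hT.union hP disjoint_sdiff
  · intro P hP
    simp only [famStar, coe_filter, Set.mem_ofPred_eq] at hP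
    exact union_sdiff_of_subset hP.2
  · intro P hP
    exact union_sdiff_cancel_left (hT.disjoint (mem_setPartitions.1 hP).2 disjoint_sdiff)

theorem card_famStar_le_lstar (F : Finset (Finset α)) (T : Finset α) :
    #(famStar F T) ≤ lstar F #T := by
  refine le_csSup ⟨#F, ?_⟩ ⟨T, rfl, rfl⟩
  rintro _ ⟨T, -, rfl⟩
  exact card_le_card (filter_subset _ _)

theorem lstar_le {F : Finset (Finset α)} {t m : ℕ}
    (h : ∀ T : Finset α, #T = t → #(famStar F T) ≤ m) : lstar F t ≤ m := by
  refine csSup_le' ?_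
  rintro _ ⟨T, hT, rfl⟩
  exact h T hT

theorem stirlingSecond_le_lstar_setPartitions {B : Finset α} {t k : ℕ} (htB : t ≤ #B)
    (htk : t ≤ k) :
    Nat.stirlingSecond (#B - t) (k - t) ≤ lstar (setPartitions B k) t := by
  obtain ⟨C, hC, rfl⟩ := exists_subset_card_eq htB
  have hcard : #(C.image singleton : Finset (Finset α)) = #C :=
    card_image_of_injective _ singleton_injective
  have := card_famStar_le_lstar (setPartitions B k) (C.image singleton)
  rwa [card_famStar_setPartitions (isSetPartition_image_singleton C) hC (by omega), hcard]
    at this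

theorem lstar_setPartitions_le_stirlingSecond {B : Finset α} {t k : ℕ} (htk : t < k) :
    lstar (setPartitions B k) t ≤ Nat.stirlingSecond (#B - t) (k - t) := by
  refine lstar_le fun T hT => ?_
  rcases (famStar (setPartitions B k) T).eq_empty_or_nonempty with h | ⟨P, hP⟩
  · simp [h]
  · simp only [famStar, mem_filter, mem_setPartitions] at hP
    obtain ⟨⟨-, hP⟩, hTP⟩ := hP
    have hsub : T.biUnion id ⊆ B := fun a ha => by
      obtain ⟨X, hX, haX⟩ := mem_biUnion.1 ha
      exact (hP.2.2 a).2 ⟨X, hTP hX, haX⟩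
    have hTT := hP.subset hTP
    rw [card_famStar_setPartitions hTT hsub (by omega), hT]
    have := hTT.card_le
    exact Nat.stirlingSecond_mono_left (by omega) (by omega)

end SetPartitions

theorem partFam_eq_setPartitions (n r : ℕ) : partFam n r = setPartitions (Icc 1 n) r := by
  ext P
  simp only [partFam, mem_filter, mem_setPartitions, IsSetPartition]
  constructor
  · rintro ⟨-, hc, h₀, h₁, h₂⟩
    refine ⟨hc, fun h => h₀ _ h rfl, fun X hX Y hY a haX haY => ?_, fun a => by simp [← h₂]⟩
    by_contra hne
    exact notMem_empty a (h₁ X hX Y hY hne ▸ mem_inter.2 ⟨haX, haY⟩)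
  · rintro ⟨hc, h₀, h₁, h₂⟩
    refine ⟨?_, hc, fun X hX h => h₀ (h ▸ hX), fun X hX Y hY hne => ?_, ?_⟩
    · exact mem_powerset.2 fun X hX => mem_powerset.2 fun a ha => (h₂ a).2 ⟨X, hX, ha⟩
    · refine eq_empty_of_forall_notMem fun a ha => hne ?_
      exact h₁ X hX Y hY a (mem_inter.1 ha).1 (mem_inter.1 ha).2
    · ext a
      rw [h₂]
      simp

/-- Lemma 4.14: (r−t−1)·l(𝖯_{n,r},t) ≥ (n−t−1)·l(𝖯_{n,r},t+1). -/
theorem stmt_18 (n r t : ℕ) (ht : 2 ≤ t + 1) (htr : t + 1 < r) (hrn : r < n) :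
    (n - t - 1) * lstar (partFam n r) (t + 1) ≤ (r - t - 1) * lstar (partFam n r) t := by
  have hupper := lstar_setPartitions_le_stirlingSecond (B := Icc 1 n) htr
  have hlower := stirlingSecond_le_lstar_setPartitions (B := Icc 1 n) (t := t) (k := r)
    (by simp; omega) (by omega)
  rw [← partFam_eq_setPartitions, Nat.card_Icc, Nat.add_sub_cancel] at hupper hlower
  have key := Nat.mul_stirlingSecond_le_mul_stirlingSecond_succ_succ
    (show r - t - 1 ≤ n - t - 1 by omega)
  rw [show n - t - 1 + 1 = n - t by omega, show r - t - 1 + 1 = r - t by omega] at key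
  exact (Nat.mul_le_mul_left _ hupper).trans (key.trans (Nat.mul_le_mul_left _ hlower))
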